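/- For every integer k ≥ 3, there exist infinitely many composite natural numbers n such that φ(n) divides (n − 1)^k, φ(n) does not divide (n − 1)^{k−1}, and n is not a Carmichael number. -/

import Mathlib

/-- The radical of a natural number: the product of its distinct prime factors,
i.e. its largest squarefree divisor. -/
def rad (n : ℕ) : ℕ := ∏ p ∈ n.primeFactors, p

/-- A composite natural number `n` is a Carmichael number if `a ^ n ≡ a (mod n)`
for every integer `a`. -/
def IsCarmichael (n : ℕ) : Prop :=
  1 < n ∧ ¬ n.Prime ∧ ∀ a : ℤ, a ^ n ≡ a [ZMOD (n : ℤ)]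

open Complex in
lemma norm_ofReal_cpow_neg_sub_le {x y : ℝ} (hy : 0 < y) (hxy : y ≤ x) {s : ℂ} (hs : 0 < s.re) :
    ‖(x : ℂ) ^ (-s) - (y : ℂ) ^ (-s)‖ ≤ ‖s‖ * y ^ (-s.re - 1) * (x - y) := by
  have hs0 : -s ≠ 0 := by
    rw [neg_ne_zero]
    rintro rfl
    simp at hs
  have key := (convex_Icc y x).norm_image_sub_le_of_norm_hasDerivWithin_le
    (f := fun t : ℝ ↦ (t : ℂ) ^ (-s)) (f' := fun t : ℝ ↦ -s * (t : ℂ) ^ (-s - 1))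
    (C := ‖s‖ * y ^ (-s.re - 1)) (x := y) (y := x)
    (fun t ht ↦ (hasDerivAt_ofReal_cpow_const (hy.trans_le ht.1).ne' hs0).hasDerivWithinAt)
    (fun t ht ↦ ?_) ⟨le_rfl, hxy⟩ ⟨hxy, le_rfl⟩
  · rwa [Real.norm_of_nonneg (sub_nonneg.mpr hxy)] at key
  · rw [norm_mul, norm_neg, norm_cpow_eq_rpow_re_of_pos (hy.trans_le ht.1)]
    simp only [sub_re, neg_re, one_re]
    gcongr ‖s‖ * ?_
    exact Real.rpow_le_rpow_of_nonpos hy ht.1 (by linarith)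

namespace DirichletCharacter

open Complex Filter Topology Metric

/-- The contribution of the integers in `[jq, (j + 1)q)` to the Dirichlet series of `χ`, after
subtracting a multiple of the vanishing sum of `χ` over a full period. -/
noncomputable def LBlock {q : ℕ} (χ : DirichletCharacter ℂ q) (j : ℕ) (s : ℂ) : ℂ :=
  ∑ a ∈ Finset.range q,
    χ a * (((j * q + a : ℕ) : ℝ) ^ (-s) - ((j * q : ℕ) : ℝ) ^ (-s) : ℂ)

variable {q : ℕ} {χ : DirichletCharacter ℂ q}

lemma sum_range_eq_zero [NeZero q] (hχ : χ ≠ 1) : ∑ a ∈ Finset.range q, χ a = 0 := by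
  rw [← MulChar.sum_eq_zero_of_ne_one hχ]
  refine Finset.sum_bij' (fun a _ ↦ (a : ZMod q)) (fun a _ ↦ a.val) (by simp)
    (fun a _ ↦ by simpa using ZMod.val_lt a) (fun a ha ↦ ?_) (by simp) (by simp)
  exact ZMod.val_cast_of_lt (Finset.mem_range.mp ha)

lemma LBlock_eq_sum [NeZero q] (hχ : χ ≠ 1) (j : ℕ) (s : ℂ) :
    LBlock χ j s = ∑ a ∈ Finset.range q,
      χ ((q * j + a : ℕ) : ZMod q) * ((q * j + a : ℕ) : ℂ) ^ (-s) := by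
  simp only [LBlock, mul_sub, Finset.sum_sub_distrib, ← Finset.sum_mul, sum_range_eq_zero hχ,
    zero_mul, sub_zero]
  refine Finset.sum_congr rfl fun a _ ↦ ?_
  congr 2
  · simp
  · push_cast; ring_nf

lemma norm_LBlock_le {j : ℕ} (hj : 0 < j) {s : ℂ} (hs : 0 < s.re) :
    ‖LBlock χ j s‖ ≤ ‖s‖ * (q : ℝ) ^ (1 - s.re) * (j : ℝ) ^ (-s.re - 1) := by
  rcases Nat.eq_zero_or_pos q with rfl | hq
  · simp only [LBlock, Finset.range_zero, Finset.sum_empty, norm_zero]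
    positivity
  have hq' : (0 : ℝ) < q := by exact_mod_cast hq
  have hj' : (0 : ℝ) < j := by exact_mod_cast hj
  calc ‖LBlock χ j s‖ ≤ ∑ a ∈ Finset.range q, ‖s‖ * ((j * q : ℕ) : ℝ) ^ (-s.re - 1) * q := by
        refine norm_sum_le_of_le _ fun a ha ↦ ?_
        rw [norm_mul]
        have h := norm_ofReal_cpow_neg_sub_le (x := ((j * q + a : ℕ) : ℝ)) (y := ((j * q : ℕ) : ℝ))
          (by positivity) (by push_cast; linarith [(Nat.cast_nonneg a : (0:ℝ) ≤ a)]) hs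
        calc _ ≤ 1 * (‖s‖ * ((j * q : ℕ) : ℝ) ^ (-s.re - 1) *
                  (((j * q + a : ℕ) : ℝ) - ((j * q : ℕ) : ℝ))) := by
              gcongr
              exact χ.norm_le_one _
          _ ≤ _ := by
              rw [one_mul]
              have : (a : ℝ) ≤ q := by exact_mod_cast (Finset.mem_range.mp ha).le
              gcongr
              push_cast; linarith
    _ = _ := by
        rw [Finset.sum_const, Finset.card_range, nsmul_eq_mul, Nat.cast_mul,
          Real.mul_rpow hj'.le hq'.le]
        have : (q : ℝ) ^ (1 - s.re) = q ^ (-s.re - 1) * q * q := by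
          rw [← Real.rpow_add_one hq'.ne', ← Real.rpow_add_one hq'.ne']
          congr 1; ring
        rw [this]; ring

lemma summable_succ_rpow_neg : Summable fun j : ℕ ↦ ((j + 1 : ℕ) : ℝ) ^ (-(3 / 2) : ℝ) :=
  (summable_nat_add_iff 1).mpr (Real.summable_nat_rpow.mpr (by norm_num))

lemma norm_le_of_mem_ball {s : ℂ} (hs : s ∈ ball (1 : ℂ) (1 / 2)) :
    1 / 2 < s.re ∧ ‖s‖ ≤ 3 / 2 := by
  rw [mem_ball, dist_eq] at hs
  constructor
  · have := (abs_re_le_norm (s - 1)).trans_lt hs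
    simp only [sub_re, one_re] at this
    linarith [(abs_lt.mp this).1]
  · have := norm_add_le (s - 1) 1
    simp only [sub_add_cancel, norm_one] at this
    linarith

lemma norm_LBlock_succ_le (hq : 0 < q) (j : ℕ) {s : ℂ} (hs : s ∈ ball (1 : ℂ) (1 / 2)) :
    ‖LBlock χ (j + 1) s‖ ≤
      3 / 2 * (q : ℝ) ^ (1 - s.re) * ((j + 1 : ℕ) : ℝ) ^ (-(3 / 2) : ℝ) := by
  obtain ⟨h1, h2⟩ := norm_le_of_mem_ball hs
  refine (norm_LBlock_le j.succ_pos (by linarith)).trans ?_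
  gcongr ?_ * _ * ?_
  · exact Real.rpow_le_rpow_of_exponent_le (by exact_mod_cast Nat.succ_pos j) (by linarith)

lemma differentiable_LBlock (j : ℕ) (hj : 0 < j) (hq : 0 < q) : Differentiable ℂ (LBlock χ j) := by
  unfold LBlock
  refine Differentiable.fun_sum fun a _ ↦ (Differentiable.sub ?_ ?_).const_mul _
  all_goals
    refine (differentiable_id.neg).const_cpow (.inl ?_)
    have := Nat.mul_pos hj hq
    rw [ofReal_ne_zero, Nat.cast_ne_zero]
    omega

lemma LFunction_eq_sum_add_tsum_of_one_lt_re [NeZero q] (hχ : χ ≠ 1) {s : ℂ}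
    (hs : 1 < s.re) (hs' : s ∈ ball (1 : ℂ) (1 / 2)) :
    LFunction χ s = LBlock χ 0 s + ∑' j, LBlock χ (j + 1) s := by
  have hq := NeZero.pos q
  have hsum : Summable fun j ↦ LBlock χ (j + 1) s :=
    .of_norm_bounded (summable_succ_rpow_neg.mul_left _) fun j ↦ norm_LBlock_succ_le hq j hs'
  have hs0 : s ≠ 0 := by rintro rfl; simp at hs; linarith
  have h1 := ((LSeriesSummable_of_one_lt_re χ hs).hasSum.tendsto_sum_nat).comp
    (tendsto_id.const_mul_atTop' hq)
  have h2 : Tendsto (fun J ↦ ∑ j ∈ Finset.range J, LBlock χ j s) atTop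
      (𝓝 (LBlock χ 0 s + ∑' j, LBlock χ (j + 1) s)) := by
    rw [← tendsto_add_atTop_iff_nat 1]
    simp_rw [Finset.sum_range_succ']
    rw [add_comm]
    exact hsum.hasSum.tendsto_sum_nat.add_const _
  rw [LFunction_eq_LSeries χ hs]
  refine tendsto_nhds_unique h1 (h2.congr fun J ↦ ?_)
  simp only [Function.comp_apply, id_eq]
  induction J with
  | zero => simp
  | succ J ih =>
    rw [Finset.sum_range_succ, ih, mul_add, mul_one, Finset.sum_range_add, LBlock_eq_sum hχ]
    congr 1
    refine Finset.sum_congr rfl fun a _ ↦ ?_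
    rw [LSeries.term_def]
    split_ifs with h
    · rw [h]; simp [hs0]
    · rw [cpow_neg, div_eq_mul_inv]

lemma LFunction_eq_sum_add_tsum [NeZero q] (hχ : χ ≠ 1) {s : ℂ} (hs : s ∈ ball (1 : ℂ) (1 / 2)) :
    LFunction χ s = LBlock χ 0 s + ∑' j, LBlock χ (j + 1) s := by
  have hq := NeZero.pos q
  have hbd : DifferentiableOn ℂ (fun s ↦ ∑' j, LBlock χ (j + 1) s) (ball (1 : ℂ) (1 / 2)) := by
    refine differentiableOn_tsum_of_summable_norm
      (u := fun j ↦ 3 / 2 * (q : ℝ) ^ (1 / 2 : ℝ) * ((j + 1 : ℕ) : ℝ) ^ (-(3 / 2) : ℝ))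
      (summable_succ_rpow_neg.mul_left _)
      (fun j ↦ (differentiable_LBlock _ j.succ_pos hq).differentiableOn) isOpen_ball
      fun j z hz ↦ (norm_LBlock_succ_le hq j hz).trans ?_
    gcongr
    · exact_mod_cast hq
    · linarith [(norm_le_of_mem_ball hz).1]
  have h0 : DifferentiableOn ℂ (LBlock χ 0) (ball (1 : ℂ) (1 / 2)) := by
    intro z hz
    have hz0 : -z ≠ 0 := by
      rw [neg_ne_zero]; rintro rfl
      have := (norm_le_of_mem_ball hz).1
      simp at this; linarith
    refine DifferentiableAt.differentiableWithinAt ?_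
    unfold LBlock
    refine DifferentiableAt.fun_sum fun a _ ↦ (DifferentiableAt.sub ?_ ?_).const_mul _
    all_goals exact (differentiableAt_id.neg).const_cpow (.inr hz0)
  have hU : IsPreconnected (ball (1 : ℂ) (1 / 2)) := (convex_ball _ _).isPreconnected
  have hmem : (1 + 1 / 4 : ℂ) ∈ ball (1 : ℂ) (1 / 2) := by
    rw [mem_ball, dist_eq]; norm_num
  refine AnalyticOnNhd.eqOn_of_preconnected_of_eventuallyEq
    ((differentiable_LFunction hχ).differentiableOn.analyticOnNhd isOpen_ball)
    ((h0.add hbd).analyticOnNhd isOpen_ball) hU hmem ?_ hs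
  have hopen : IsOpen {z : ℂ | 1 < z.re} := isOpen_lt continuous_const continuous_re
  filter_upwards [hopen.mem_nhds (x := (1 + 1 / 4 : ℂ)) (by simp), isOpen_ball.mem_nhds hmem]
    with z h1 h2
  exact LFunction_eq_sum_add_tsum_of_one_lt_re hχ h1 h2

lemma norm_LBlock_zero_le (hq : 1 < q) {L : ℝ} (hL : 1 ≤ L) (hqL : Real.log q ≤ L) {s : ℂ}
    (hs : 1 - 1 / L ≤ s.re) (hs' : s ∈ ball (1 : ℂ) (1 / 2)) : ‖LBlock χ 0 s‖ ≤ 6 * L := by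
  have : NeZero q := ⟨by omega⟩
  have hs0 : -s ≠ 0 := by
    rw [neg_ne_zero]; rintro rfl
    have := (norm_le_of_mem_ball hs').1
    simp at this; linarith
  have hterm (a : ℕ) (ha : a < q) (ha0 : 0 < a) : (a : ℝ) ^ (-s.re) ≤ 3 * (a : ℝ)⁻¹ := by
    have ha' : (1 : ℝ) ≤ a := by exact_mod_cast ha0
    calc (a : ℝ) ^ (-s.re) ≤ (a : ℝ) ^ (1 / L + -1) :=
          Real.rpow_le_rpow_of_exponent_le ha' (by linarith)
      _ = (a : ℝ) ^ (1 / L) * (a : ℝ)⁻¹ := by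
          rw [Real.rpow_add (by linarith), Real.rpow_neg_one]
      _ ≤ _ := by
          gcongr
          rw [Real.rpow_def_of_pos (by linarith)]
          refine (Real.exp_le_exp.mpr ?_).trans Real.exp_one_lt_three.le
          rw [mul_one_div, div_le_one (by linarith)]
          exact (Real.log_le_log (by linarith) (by exact_mod_cast ha.le)).trans hqL
  have hharm : ∑ a ∈ Finset.range q, 3 * (a : ℝ)⁻¹ ≤ 6 * L := by
    have h := harmonic_le_one_add_log (q - 1)
    rw [harmonic_eq_sum_Icc] at h
    push_cast at h
    rw [← Finset.mul_sum, Finset.range_eq_Ico, Finset.sum_eq_sum_Ico_succ_bot (by omega)]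
    have h2 : Finset.Ico (0 + 1) q = Finset.Icc 1 (q - 1) := by ext; simp; omega
    have h3 : Real.log ((q - 1 : ℕ) : ℝ) ≤ Real.log q :=
      Real.log_le_log (by exact_mod_cast (by omega : 0 < q - 1)) (by exact_mod_cast Nat.sub_le _ _)
    rw [h2]
    simp only [Nat.cast_zero, inv_zero, zero_add]
    linarith
  refine le_trans (norm_sum_le_of_le _ fun a ha ↦ ?_) hharm
  rcases Nat.eq_zero_or_pos a with rfl | ha0
  · simp
  · rw [norm_mul]
    have ha' : (0 : ℝ) < a := by exact_mod_cast ha0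
    have h1 : ((0 * q : ℕ) : ℝ) = 0 := by simp
    rw [h1, zero_mul, zero_add, ofReal_zero, zero_cpow hs0, sub_zero,
      norm_cpow_eq_rpow_re_of_pos ha', neg_re]
    calc _ ≤ 1 * (3 * (a : ℝ)⁻¹) := by
          gcongr
          · exact χ.norm_le_one _
          · exact hterm a (Finset.mem_range.mp ha) ha0
      _ = _ := one_mul _

/-- A nontrivial Dirichlet `L`-function is bounded logarithmically in the modulus near `1`. -/
lemma exists_norm_LFunction_le : ∃ C : ℝ, 1 ≤ C ∧ ∀ {q : ℕ} [NeZero q] (_ : 1 < q)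
    (χ : DirichletCharacter ℂ q) (_ : χ ≠ 1) {L : ℝ} (_ : 1 ≤ L) (_ : Real.log q ≤ L) {s : ℂ}
    (_ : 1 - 1 / L ≤ s.re) (_ : s ∈ ball (1 : ℂ) (1 / 2)), ‖LFunction χ s‖ ≤ C * L := by
  set Z := ∑' j : ℕ, ((j + 1 : ℕ) : ℝ) ^ (-(3 / 2) : ℝ) with hZ
  have hZ0 : 0 ≤ Z := tsum_nonneg fun j ↦ by positivity
  refine ⟨6 + 9 / 2 * Z, by linarith, fun {q} _ hq χ hχ {L} hL hqL {s} hs hs' ↦ ?_⟩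
  rw [LFunction_eq_sum_add_tsum hχ hs']
  have hq' : (1 : ℝ) < q := by exact_mod_cast hq
  have hpow : (q : ℝ) ^ (1 - s.re) ≤ 3 := by
    calc (q : ℝ) ^ (1 - s.re) ≤ (q : ℝ) ^ (1 / L) :=
          Real.rpow_le_rpow_of_exponent_le hq'.le (by linarith)
      _ ≤ 3 := by
          rw [Real.rpow_def_of_pos (by linarith)]
          refine (Real.exp_le_exp.mpr ?_).trans Real.exp_one_lt_three.le
          rw [mul_one_div, div_le_one (by linarith)]
          exact hqL
  have hbound : ‖∑' j, LBlock χ (j + 1) s‖ ≤ 3 / 2 * (q : ℝ) ^ (1 - s.re) * Z := by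
    refine tsum_of_norm_bounded ?_ fun j ↦ norm_LBlock_succ_le (by omega) j hs'
    exact summable_succ_rpow_neg.hasSum.mul_left _
  have h0 := norm_LBlock_zero_le (χ := χ) hq hL hqL hs hs'
  calc _ ≤ 6 * L + 3 / 2 * (q : ℝ) ^ (1 - s.re) * Z :=
      (norm_add_le _ _).trans (add_le_add h0 hbound)
    _ ≤ 6 * L + 3 / 2 * 3 * Z := by gcongr
    _ ≤ 6 * L + 3 / 2 * 3 * Z * L := by nlinarith
    _ = _ := by ring

end DirichletCharacter

lemma tsum_inv_succ_rpow_le {ε : ℝ} (hε : 0 < ε) :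
    ∑' m : ℕ, 1 / ((m + 1 : ℕ) : ℝ) ^ (1 + ε) ≤ 1 + 1 / ε := by
  have h := ZetaAsymptotics.zeta_limit_aux1 (s := 1 + ε) (by linarith)
  have h0 : 0 ≤ ZetaAsymptotics.termTSum (1 + ε) :=
    tsum_nonneg fun n ↦ ZetaAsymptotics.term_nonneg _ _
  rw [add_sub_cancel_left] at h
  push_cast
  nlinarith

namespace DirichletCharacter

open Complex Filter Topology Metric

lemma norm_LFunctionTrivChar_le {q : ℕ} [NeZero q] {ε : ℝ} (hε : 0 < ε) :
    ‖LFunctionTrivChar q (1 + ε)‖ ≤ 1 + 1 / ε := by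
  have hs : 1 < (1 + ε : ℂ).re := by simpa using hε
  rw [LFunctionTrivChar, LFunction_eq_LSeries _ hs, LSeries]
  have hsum : Summable fun m : ℕ ↦ 1 / (m : ℝ) ^ (1 + ε) :=
    Real.summable_one_div_nat_rpow.mpr (by linarith)
  refine le_trans (tsum_of_norm_bounded (g := fun m : ℕ ↦ 1 / (m : ℝ) ^ (1 + ε)) hsum.hasSum
    fun m ↦ ?_) ?_
  · rw [LSeries.norm_term_eq]
    split_ifs
    · positivity
    · simp only [add_re, one_re, ofReal_re]
      gcongr
      exact norm_le_one _ _
  · rw [hsum.tsum_eq_zero_add, Nat.cast_zero, Real.zero_rpow (by linarith), div_zero, zero_add]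
    exact tsum_inv_succ_rpow_le hε

/-- A non-real Dirichlet `L`-function has no zeros in a small disc around `1` whose radius is
polylogarithmic in the modulus, with a corresponding bound for its logarithmic derivative. -/
lemma exists_zeroFree_of_sq_ne_one : ∃ C : ℝ, 1 ≤ C ∧ ∀ {q : ℕ} [NeZero q] (_ : 1 < q)
    (χ : DirichletCharacter ℂ q) (_ : χ ^ 2 ≠ 1) {L : ℝ} (_ : 2 ≤ L) (_ : Real.log q ≤ L)
    {δ : ℝ} (_ : δ = 1 / (C * L ^ 9)) {s : ℂ} (_ : s ∈ ball (1 : ℂ) δ),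
      LFunction χ s ≠ 0 ∧ ‖deriv (LFunction χ) s / LFunction χ s‖ ≤ 1 / δ := by
  obtain ⟨C, hC1, hC⟩ := exists_norm_LFunction_le
  refine ⟨(8 * C) ^ 5, one_le_pow₀ (by linarith), fun {q} _ hq χ hχ2 {L} hL hqL {δ} hδ {s} hs ↦ ?_⟩
  have hχ : χ ≠ 1 := by rintro rfl; exact hχ2 (one_pow 2)
  have hL0 : 0 < L := by linarith
  have hC0 : 0 < C := by linarith
  have hδ0 : 0 < δ := by rw [hδ]; positivity
  have hLinv : 1 / L ≤ 1 / 2 := one_div_le_one_div_of_le two_pos hL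
  have hδL : 8 * δ ≤ 1 / L := by
    rw [hδ, mul_one_div, div_le_div_iff₀ (by positivity) hL0]
    have h1 : 1 ≤ C ^ 5 := one_le_pow₀ hC1
    have h2 : L ≤ L ^ 9 := le_self_pow₀ (by linarith) (by norm_num)
    have h3 : L ^ 9 ≤ C ^ 5 * L ^ 9 := le_mul_of_one_le_left (by positivity) h1
    rw [mul_pow]
    nlinarith
  have hbd (ψ : DirichletCharacter ℂ q) (hψ : ψ ≠ 1) {z : ℂ} (hz : ‖z - 1‖ < 1 / L) :
      ‖LFunction ψ z‖ ≤ C * L := by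
    refine hC hq ψ hψ (by linarith) hqL ?_ (by rw [mem_ball, dist_eq]; linarith)
    have := (abs_re_le_norm (z - 1)).trans_lt hz
    simp only [sub_re, one_re] at this
    linarith [(abs_lt.mp this).1]
  have hderiv {z : ℂ} (hz : z ∈ ball (1 : ℂ) (1 / (2 * L))) :
      ‖deriv (LFunction χ) z‖ ≤ 2 * C * L ^ 2 := by
    have h := norm_deriv_le_of_forall_mem_sphere_norm_le (f := LFunction χ) (c := z)
      (R := 1 / (2 * L)) (C := C * L) (by positivity)
      (differentiable_LFunction hχ).diffContOnCl fun w hw ↦ hbd χ hχ ?_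
    · refine h.trans_eq ?_
      field_simp
    · rw [mem_sphere, dist_eq] at hw
      rw [mem_ball, dist_eq] at hz
      have := norm_add_le (w - z) (z - 1)
      rw [sub_add_sub_cancel] at this
      have h2 : 1 / L = 1 / (2 * L) + 1 / (2 * L) := by field_simp; norm_num
      linarith
  have hhalf : 1 / (2 * L) = 1 / L / 2 := by field_simp
  rw [mem_ball, dist_eq] at hs
  set s' : ℂ := 1 + δ + I * s.im with hs'
  have hre : |s.re - 1| < δ := by
    have := (abs_re_le_norm (s - 1)).trans_lt hs
    simpa using this
  have him : |s.im| < δ := by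
    have := (abs_im_le_norm (s - 1)).trans_lt hs
    simpa using this
  have hss' : ‖s' - s‖ ≤ 2 * δ := by
    have : s' - s = ((1 + δ - s.re : ℝ) : ℂ) := by
      apply Complex.ext <;> simp [hs']
    rw [this, norm_real, Real.norm_eq_abs, abs_le]
    rw [abs_lt] at hre
    constructor <;> linarith
  have hs'1 : ‖s' - 1‖ ≤ 3 * δ := by
    have := norm_add_le (s' - s) (s - 1)
    rw [sub_add_sub_cancel] at this
    linarith
  have hs'' : ‖(1 + δ + 2 * I * s.im : ℂ) - 1‖ ≤ 3 * δ := by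
    have h1 : (1 + δ + 2 * I * s.im : ℂ) - 1 = (δ : ℂ) + 2 * I * (s.im : ℂ) := by ring
    rw [h1]
    refine (norm_add_le _ _).trans ?_
    simp only [norm_mul, norm_real, Real.norm_eq_abs, norm_I, norm_ofNat, abs_of_pos hδ0]
    linarith
  have hdiff : ‖LFunction χ s' - LFunction χ s‖ ≤ 4 * C * δ * L ^ 2 := by
    have h := (convex_ball (1 : ℂ) (1 / (2 * L))).norm_image_sub_le_of_norm_deriv_le
      (f := LFunction χ) (C := 2 * C * L ^ 2) (x := s) (y := s')
      (fun z _ ↦ (differentiable_LFunction hχ) z) (fun z hz ↦ hderiv hz)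
      (by rw [mem_ball, dist_eq]; linarith) (by rw [mem_ball, dist_eq]; linarith)
    calc _ ≤ 2 * C * L ^ 2 * (2 * δ) := h.trans (by gcongr)
      _ = _ := by ring
  have hlower : 8 * C * δ * L ^ 2 ≤ ‖LFunction χ s'‖ := by
    by_contra! hlt
    have h1 := norm_LFunction_product_ge_one χ hδ0 s.im
    rw [norm_mul, norm_mul, norm_pow, norm_pow] at h1
    have h2 : ‖LFunctionTrivChar q (1 + δ)‖ ≤ 2 / δ := by
      refine (norm_LFunctionTrivChar_le hδ0).trans ?_
      have : 1 ≤ 1 / δ := by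
        rw [le_div_iff₀ hδ0]; linarith
      rw [show 2 / δ = 1 / δ + 1 / δ by ring]
      linarith
    have h3 : ‖LFunction (χ ^ 2) (1 + δ + 2 * I * s.im)‖ ≤ C * L := hbd _ hχ2 (by linarith)
    have h4 : ‖LFunctionTrivChar q (1 + δ)‖ ^ 3 * ‖LFunction χ s'‖ ^ 4 *
        ‖LFunction (χ ^ 2) (1 + δ + 2 * I * s.im)‖ < 1 := by
      calc _ ≤ (2 / δ) ^ 3 * ‖LFunction χ s'‖ ^ 4 * (C * L) := by gcongr
        _ < (2 / δ) ^ 3 * (8 * C * δ * L ^ 2) ^ 4 * (C * L) := by gcongr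
        _ = (8 * C) ^ 5 * L ^ 9 * δ := by field_simp; ring
        _ = 1 := by rw [hδ]; field_simp
    linarith
  have hs_lower : 4 * C * δ * L ^ 2 ≤ ‖LFunction χ s‖ := by
    have := norm_sub_norm_le (LFunction χ s') (LFunction χ s)
    linarith
  have hpos : 0 < 4 * C * δ * L ^ 2 := by positivity
  refine ⟨norm_pos_iff.mp (hpos.trans_le hs_lower), ?_⟩
  rw [norm_div]
  calc _ ≤ 2 * C * L ^ 2 / (4 * C * δ * L ^ 2) := by
        gcongr
        exact hderiv (by rw [mem_ball, dist_eq]; linarith)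
    _ = 1 / 2 * (1 / δ) := by field_simp; norm_num
    _ ≤ _ := by linarith [one_div_pos.mpr hδ0]

end DirichletCharacter

open Filter Topology Metric in
lemma eventually_norm_deriv_div_le {f : ℂ → ℂ} (hf : Differentiable ℂ f) {c : ℂ} (hc : f c ≠ 0) :
    ∃ B : ℝ, ∀ᶠ s in 𝓝 c, f s ≠ 0 ∧ ‖deriv f s / f s‖ ≤ B := by
  have hcont : ContinuousAt (fun s ↦ ‖deriv f s / f s‖) c :=
    (((hf.contDiff (n := 1)).continuous_deriv le_rfl).continuousAt.div
      hf.continuous.continuousAt hc).norm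
  refine ⟨‖deriv f c / f c‖ + 1, (hf.continuous.continuousAt.eventually_ne hc).and ?_⟩
  exact (hcont.eventually (gt_mem_nhds (lt_add_one _))).mono fun s hs ↦ hs.le

namespace DirichletCharacter

open Complex Filter Topology Metric

lemma factorsThrough_of_sq_eq_one {Q q K : ℕ} [NeZero q] (hQ : _root_.Odd Q) (hQq : Q ∣ q)
    (hqQ : q ∣ Q ^ K) {χ : DirichletCharacter ℂ q} (hχ : χ ^ 2 = 1) : χ.FactorsThrough Q := by
  rw [factorsThrough_iff_ker_unitsMap hQq]
  intro u hu
  rw [MonoidHom.mem_ker] at hu ⊢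
  have h2 : χ u ^ 2 = 1 := by
    rw [← MulChar.pow_apply_coe, hχ, MulChar.one_apply_coe]
  have hu1 : (u : ZMod q) ^ Q ^ K = 1 := by
    have hcast : ((u : ZMod q).val : ZMod q) = u := ZMod.natCast_zmod_val _
    have hQ0 : (((u : ZMod q).val : ℕ) : ZMod Q) = 1 := by
      have := congrArg Units.val hu
      rw [ZMod.unitsMap_val, Units.val_one] at this
      rw [← this, ← ZMod.natCast_val]
    rw [← hcast]
    have hdvd : (Q : ℤ) ∣ ((u : ZMod q).val : ℤ) - 1 := by
      rw [← ZMod.intCast_zmod_eq_zero_iff_dvd]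
      push_cast
      rw [hQ0, sub_self]
    have hpow : ∀ k : ℕ, (Q : ℤ) ^ k ∣ ((u : ZMod q).val : ℤ) ^ Q ^ k - 1 := by
      intro k
      have := dvd_sub_pow_of_dvd_sub hdvd k
      rw [one_pow] at this
      exact (pow_dvd_pow _ (Nat.le_succ k)).trans this
    have hq : (q : ℤ) ∣ ((u : ZMod q).val : ℤ) ^ Q ^ K - 1 :=
      dvd_trans (by exact_mod_cast hqQ) (hpow K)
    rw [← ZMod.intCast_zmod_eq_zero_iff_dvd] at hq
    push_cast at hq
    exact sub_eq_zero.mp hq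
  have h3 : χ u ^ Q ^ K = 1 := by rw [← map_pow, hu1, map_one]
  obtain ⟨t, ht⟩ := hQ.pow (n := K)
  rw [ht, pow_succ, pow_mul, h2, one_pow, one_mul] at h3
  ext
  simpa using h3

lemma primeFactors_eq_of_dvd_of_dvd_pow {Q q K : ℕ} (hQ : Q ≠ 0) (hQq : Q ∣ q)
    (hqQ : q ∣ Q ^ K) : q.primeFactors = Q.primeFactors := by
  have hq : q ≠ 0 := by rintro rfl; exact pow_ne_zero K hQ (zero_dvd_iff.mp hqQ)
  refine Finset.Subset.antisymm ?_ (Nat.primeFactors_mono hQq hq)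
  rw [← Nat.primeFactors_pow_succ Q K]
  exact Nat.primeFactors_mono (hqQ.trans (pow_dvd_pow Q K.le_succ)) (pow_ne_zero _ hQ)

lemma exists_LFunction_eq_of_sq_eq_one {Q q K : ℕ} [NeZero Q] [NeZero q] (hQ : _root_.Odd Q)
    (hQq : Q ∣ q) (hqQ : q ∣ Q ^ K) {χ : DirichletCharacter ℂ q} (hχ1 : χ ≠ 1) (hχ : χ ^ 2 = 1) :
    ∃ ψ : DirichletCharacter ℂ Q, ψ ≠ 1 ∧ LFunction χ = LFunction ψ := by
  obtain ⟨hd, ψ, hψ⟩ := factorsThrough_of_sq_eq_one hQ hQq hqQ hχ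
  have hψ1 : ψ ≠ 1 := by rintro rfl; exact hχ1 (by rw [hψ, map_one])
  refine ⟨ψ, hψ1, funext fun s ↦ ?_⟩
  rw [hψ, LFunction_changeLevel hQq ψ (.inl hψ1),
    primeFactors_eq_of_dvd_of_dvd_pow (NeZero.ne Q) hQq hqQ, Finset.prod_eq_one, mul_one]
  intro p hp
  have hp' := Nat.prime_of_mem_primeFactors hp
  rw [ψ.map_nonunit, zero_mul, sub_zero]
  rw [ZMod.isUnit_prime_iff_not_dvd hp', not_not]
  exact Nat.dvd_of_mem_primeFactors hp

lemma LFunctionTrivChar₁_eq_of_primeFactors_eq {Q q : ℕ} [NeZero Q] [NeZero q]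
    (h : q.primeFactors = Q.primeFactors) :
    LFunctionTrivChar₁ q = LFunctionTrivChar₁ Q := by
  funext s
  rcases eq_or_ne s 1 with rfl | hs
  · simp [LFunctionTrivChar₁, h]
  · simp only [LFunctionTrivChar₁, Function.update_of_ne hs,
      LFunctionTrivChar_eq_mul_riemannZeta hs, h]

/-- For moduli having the same prime factors as a fixed odd `Q`, all Dirichlet `L`-functions are
free of zeros in a common disc around `1` whose radius is polylogarithmic in the modulus, with a
corresponding bound for the logarithmic derivatives. -/
lemma exists_zeroFree_of_dvd_pow {Q : ℕ} (hQ : _root_.Odd Q) (hQ1 : 1 < Q) :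
    ∃ C : ℝ, 1 ≤ C ∧ ∃ L₀ : ℝ, ∀ {q K : ℕ} [NeZero q] (_ : Q ∣ q) (_ : q ∣ Q ^ K)
      {L : ℝ} (_ : L₀ ≤ L) (_ : Real.log q ≤ L) {s : ℂ} (_ : s ∈ ball (1 : ℂ) (1 / (C * L ^ 9))),
      (LFunctionTrivChar₁ q s ≠ 0 ∧
        ‖deriv (LFunctionTrivChar₁ q) s / LFunctionTrivChar₁ q s‖ ≤ C * L ^ 9) ∧
      ∀ χ : DirichletCharacter ℂ q, χ ≠ 1 →
        LFunction χ s ≠ 0 ∧ ‖deriv (LFunction χ) s / LFunction χ s‖ ≤ C * L ^ 9 := by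
  have : NeZero Q := ⟨by omega⟩
  obtain ⟨C, hC1, hC⟩ := exists_zeroFree_of_sq_ne_one
  obtain ⟨B₁, hB₁⟩ := eventually_norm_deriv_div_le (differentiable_LFunctionTrivChar₁ Q)
    (LFunctionTrivChar₁_apply_one_ne_zero Q)
  have hψ (ψ : {ψ : DirichletCharacter ℂ Q // ψ ≠ 1}) : ∃ B : ℝ, ∀ᶠ s in 𝓝 (1 : ℂ),
      LFunction ψ.1 s ≠ 0 ∧ ‖deriv (LFunction ψ.1) s / LFunction ψ.1 s‖ ≤ B :=
    eventually_norm_deriv_div_le (differentiable_LFunction ψ.2) (LFunction_apply_one_ne_zero ψ.2)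
  choose B hB using hψ
  obtain ⟨r, hr, hball⟩ := Metric.eventually_nhds_iff_ball.mp (hB₁.and (eventually_all.mpr hB))
  obtain ⟨B₂, hB₂⟩ := (Set.finite_range B).bddAbove
  refine ⟨C, hC1, max (max 2 (1 / r)) (max B₁ B₂), fun {q K} _ hQq hqQ {L} hL hqL {s} hs ↦ ?_⟩
  simp only [sup_le_iff] at hL
  obtain ⟨⟨hL2, hLr⟩, hLB₁, hLB₂⟩ := hL
  have hL0 : 0 < L := by linarith
  have hle : L ≤ C * L ^ 9 := by
    have h2 : L ≤ L ^ 9 := le_self_pow₀ (by linarith) (by norm_num)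
    have h3 : L ^ 9 ≤ C * L ^ 9 := le_mul_of_one_le_left (by positivity) hC1
    linarith
  have hsr : s ∈ ball (1 : ℂ) r := by
    refine ball_subset_ball ?_ hs
    rw [one_div_le (by linarith) hr]
    linarith
  obtain ⟨⟨h0, h1⟩, h2⟩ := hball s hsr
  refine ⟨?_, fun χ hχ ↦ ?_⟩
  · rw [LFunctionTrivChar₁_eq_of_primeFactors_eq
      (primeFactors_eq_of_dvd_of_dvd_pow (NeZero.ne Q) hQq hqQ)]
    exact ⟨h0, by linarith⟩
  · by_cases hχ2 : χ ^ 2 = 1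
    · obtain ⟨ψ, hψ1, hψ⟩ := exists_LFunction_eq_of_sq_eq_one hQ hQq hqQ hχ hχ2
      rw [hψ]
      have := h2 ⟨ψ, hψ1⟩
      have hb := hB₂ (Set.mem_range_self (⟨ψ, hψ1⟩ : {ψ : DirichletCharacter ℂ Q // ψ ≠ 1}))
      exact ⟨this.1, by linarith [this.2]⟩
    · have := hC (hQ1.trans_le (Nat.le_of_dvd (NeZero.pos q) hQq)) χ hχ2 hL2 hqL rfl hs
      rwa [one_div_one_div] at this

end DirichletCharacter

namespace ArithmeticFunction.vonMangoldt

open Complex Filter Topology Metric DirichletCharacter LSeries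

variable {q : ℕ}

lemma logMul_iterate_apply (f : ℕ → ℂ) (j n : ℕ) :
    (logMul^[j] f) n = (Complex.log n) ^ j * f n := by
  induction j with
  | zero => simp
  | succ j ih => rw [Function.iterate_succ_apply', logMul, ih, pow_succ]; ring

lemma term_logMul_iterate_residueClass (a : ZMod q) (j n : ℕ) (x : ℝ) :
    term (logMul^[j] fun n : ℕ ↦ (residueClass a n : ℂ)) x n =
      ((residueClass a n * Real.log n ^ j / (n : ℝ) ^ x : ℝ) : ℂ) := by
  rcases eq_or_ne n 0 with rfl | hn
  · rw [term_zero, residueClass_apply_zero]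
    simp
  · rw [term_of_ne_zero hn, logMul_iterate_apply, ← natCast_log]
    push_cast [Complex.ofReal_cpow n.cast_nonneg]
    ring

lemma abscissaOfAbsConv_residueClass_lt (a : ZMod q) {x : ℝ} (hx : 1 < x) :
    abscissaOfAbsConv (fun n : ℕ ↦ (residueClass a n : ℂ)) < (x : ℂ).re :=
  (abscissaOfAbsConv_residueClass_le_one a).trans_lt (by rw [ofReal_re]; exact_mod_cast hx)

lemma summable_residueClass_mul_log_pow (a : ZMod q) (j : ℕ) {x : ℝ} (hx : 1 < x) :
    Summable fun n : ℕ ↦ residueClass a n * Real.log n ^ j / (n : ℝ) ^ x := by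
  have h : LSeriesSummable (logMul^[j] fun n : ℕ ↦ (residueClass a n : ℂ)) x :=
    LSeriesSummable_of_abscissaOfAbsConv_lt_re
      (by rw [absicssaOfAbsConv_logPowMul]; exact abscissaOfAbsConv_residueClass_lt a hx)
  exact Complex.summable_ofReal.mp (h.congr fun n ↦ term_logMul_iterate_residueClass a j n x)

variable [NeZero q]

lemma iteratedDeriv_LFunctionResidueClassAux {a : ZMod q} (ha : IsUnit a) (j : ℕ) {η : ℝ}
    (hη : 0 < η) :
    iteratedDeriv j (LFunctionResidueClassAux a) ((1 + η : ℝ) : ℂ) =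
      (-1) ^ j * ((∑' n : ℕ, residueClass a n * Real.log n ^ j / (n : ℝ) ^ (1 + η) -
        (q.totient : ℝ)⁻¹ * (j.factorial / η ^ (j + 1)) : ℝ) : ℂ) := by
  have hx : 1 < 1 + η := by linarith
  have hopen : {s : ℂ | 1 < s.re} ∈ 𝓝 ((1 + η : ℝ) : ℂ) :=
    (isOpen_lt continuous_const continuous_re).mem_nhds (by simpa using hη)
  rw [Filter.EventuallyEq.iteratedDeriv_eq j
    ((eqOn_LFunctionResidueClassAux ha).eventuallyEq_of_mem hopen)]
  have hη' : (η : ℂ) ≠ 0 := by exact_mod_cast hη.ne'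
  have hlt := abscissaOfAbsConv_residueClass_lt a hx
  rw [iteratedDeriv_fun_sub ((LSeries_analyticOnNhd _ _ hlt).contDiffAt),
    LSeries_iteratedDeriv j hlt]
  · simp_rw [div_eq_mul_inv _ (_ - (1 : ℂ))]
    rw [iteratedDeriv_const_mul_field, iteratedDeriv_comp_sub_const j (fun z : ℂ ↦ z⁻¹),
      iteratedDeriv_eq_iterate]
    have := iter_deriv_inv (𝕜 := ℂ) j (((1 + η : ℝ) : ℂ) - 1)
    rw [show (fun z : ℂ ↦ z⁻¹) = Inv.inv from rfl]
    beta_reduce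
    rw [this, LSeries]
    simp_rw [term_logMul_iterate_residueClass]
    rw [← Complex.ofReal_tsum]
    have hpow : (((1 + η : ℝ) : ℂ) - 1) ^ (-1 - (j : ℤ)) = ((η : ℂ) ^ (j + 1))⁻¹ := by
      rw [show ((1 + η : ℝ) : ℂ) - 1 = η by push_cast; ring, ← zpow_natCast, ← zpow_neg]
      congr 1
      push_cast
      ring
    rw [hpow]
    push_cast
    ring
  · refine contDiffAt_const.div (contDiffAt_id.sub contDiffAt_const) ?_
    simpa using hη'

lemma norm_LFunctionResidueClassAux_le {D : ℝ} {s : ℂ}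
    (h₁ : ‖deriv (LFunctionTrivChar₁ q) s / LFunctionTrivChar₁ q s‖ ≤ D)
    (h₂ : ∀ χ : DirichletCharacter ℂ q, χ ≠ 1 → ‖deriv (LFunction χ) s / LFunction χ s‖ ≤ D) :
    ‖LFunctionResidueClassAux (1 : ZMod q) s‖ ≤ D := by
  have hφ : 0 < (q.totient : ℝ) := by exact_mod_cast Nat.totient_pos.mpr (NeZero.pos q)
  have hcard : Fintype.card (DirichletCharacter ℂ q) = q.totient := by
    rw [← Nat.card_eq_fintype_card, card_eq_totient_of_hasEnoughRootsOfUnity ℂ q]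
  rw [LFunctionResidueClassAux, norm_mul, norm_inv, norm_natCast, inv_mul_le_iff₀ hφ]
  refine (norm_sub_le _ _).trans ?_
  rw [neg_div, norm_neg]
  refine (add_le_add h₁ ((norm_sum_le _ _).trans
    (Finset.sum_le_card_nsmul _ _ D fun χ hχ ↦ ?_))).trans ?_
  · rw [mul_div_assoc, norm_mul]
    exact mul_le_of_le_one_left (norm_nonneg _) (χ.norm_le_one _) |>.trans
      (h₂ χ (by simpa using hχ))
  · rw [@Finset.card_compl _ (fun a b ↦ Classical.propDecidable (a = b)), Finset.card_singleton,
      hcard, nsmul_eq_mul, Nat.cast_sub (Nat.totient_pos.mpr (NeZero.pos q))]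
    push_cast
    linarith

/-- If all `L`-functions modulo `q` have no zeros in a disc around `1` and bounded logarithmic
derivatives there, then the sums of `Λ(n) (log n) ^ j n ^ (-1 - η)` over `n ≡ 1` modulo `q` are as
large as expected for suitable `j` and `η`. -/
lemma le_tsum_residueClass_mul_log_pow {D : ℝ} (hD : 1 ≤ D)
    (h₁ : ∀ s ∈ ball (1 : ℂ) (1 / D), LFunctionTrivChar₁ q s ≠ 0 ∧
      ‖deriv (LFunctionTrivChar₁ q) s / LFunctionTrivChar₁ q s‖ ≤ D)
    (h₂ : ∀ s ∈ ball (1 : ℂ) (1 / D), ∀ χ : DirichletCharacter ℂ q, χ ≠ 1 →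
      LFunction χ s ≠ 0 ∧ ‖deriv (LFunction χ) s / LFunction χ s‖ ≤ D)
    {η : ℝ} (hη : η = 1 / (16 * D)) {j : ℕ} (hj : (q : ℝ) ≤ 8 ^ j) :
    3 / 4 * (j.factorial / (q * η ^ (j + 1))) ≤
      ∑' n : ℕ, residueClass (1 : ZMod q) n * Real.log n ^ j / (n : ℝ) ^ (1 + η) := by
  have hD0 : 0 < D := by linarith
  have hη0 : 0 < η := by rw [hη]; positivity
  have hφ : 0 < (q.totient : ℝ) := by exact_mod_cast Nat.totient_pos.mpr (NeZero.pos q)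
  have hq0 : 0 < (q : ℝ) := by exact_mod_cast NeZero.pos q
  have hφq : (q.totient : ℝ) ≤ q := by exact_mod_cast Nat.totient_le q
  have hsub : closedBall ((1 + η : ℝ) : ℂ) (1 / (2 * D)) ⊆ ball (1 : ℂ) (1 / D) := by
    refine closedBall_subset_ball' ?_
    rw [dist_eq, show ((1 + η : ℝ) : ℂ) - 1 = η by push_cast; ring, norm_real,
      Real.norm_of_nonneg hη0.le, hη, div_add_div _ _ (by positivity) (by positivity),
      div_lt_div_iff₀ (by positivity) hD0]
    nlinarith [mul_pos hD0 (mul_pos hD0 hD0)]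
  have hdiff : DifferentiableOn ℂ (LFunctionResidueClassAux (1 : ZMod q)) (ball 1 (1 / D)) := by
    intro s hs
    refine (DifferentiableAt.const_mul (DifferentiableAt.sub ?_ ?_) _).differentiableWithinAt
    · exact (((differentiable_LFunctionTrivChar₁ q).contDiff (n := 2)).differentiable_deriv_two
        s).neg.div (differentiable_LFunctionTrivChar₁ q s) (h₁ s hs).1
    · refine DifferentiableAt.fun_sum fun χ hχ ↦ ?_
      have hχ' : χ ≠ 1 := by simpa using hχ
      exact (((differentiable_LFunction hχ').contDiff (n := 2)).differentiable_deriv_two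
        s).const_mul _ |>.div (differentiable_LFunction hχ' s) (h₂ s hs χ hχ').1
  have hbound := norm_iteratedDeriv_le_of_forall_mem_sphere_norm_le (c := ((1 + η : ℝ) : ℂ))
    (R := 1 / (2 * D)) (C := D) j (by positivity)
    ((hdiff.mono hsub).diffContOnCl_ball (U := closedBall ((1 + η : ℝ) : ℂ) (1 / (2 * D)))
      subset_rfl)
    (fun s hs ↦ norm_LFunctionResidueClassAux_le
      (h₁ s (hsub (sphere_subset_closedBall hs))).2
      fun χ hχ ↦ (h₂ s (hsub (sphere_subset_closedBall hs)) χ hχ).2)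
  rw [iteratedDeriv_LFunctionResidueClassAux isUnit_one j hη0, norm_mul, norm_pow, norm_neg,
    norm_one, one_pow, one_mul, norm_real, Real.norm_eq_abs] at hbound
  have hlow := (abs_le.mp hbound).1
  set S := ∑' n : ℕ, residueClass (1 : ZMod q) n * Real.log n ^ j / (n : ℝ) ^ (1 + η)
  have hmain : (j.factorial / (q * η ^ (j + 1)) : ℝ) ≤
      (q.totient : ℝ)⁻¹ * (j.factorial / η ^ (j + 1)) := by
    rw [div_mul_eq_div_div_swap, div_eq_inv_mul]
    gcongr
  have herr : (j.factorial * D / (1 / (2 * D)) ^ j : ℝ) ≤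
      1 / 4 * (j.factorial / (q * η ^ (j + 1))) := by
    have hpos : 0 < (j.factorial : ℝ) := by exact_mod_cast j.factorial_pos
    have e1 : (j.factorial * D / (1 / (2 * D)) ^ j : ℝ) = j.factorial * D ^ (j + 1) * 2 ^ j := by
      rw [one_div, inv_pow, div_inv_eq_mul, mul_pow]; ring
    have e2 : (j.factorial / (q * η ^ (j + 1)) : ℝ) =
        j.factorial * D ^ (j + 1) * (16 ^ (j + 1) / q) := by
      rw [hη, one_div, inv_pow, mul_pow]
      field_simp
    have e3 : (2 : ℝ) ^ j ≤ 1 / 4 * (16 ^ (j + 1) / q) := by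
      rw [← mul_div_assoc, le_div_iff₀ hq0, pow_succ,
        show (16 : ℝ) ^ j = 2 ^ j * 8 ^ j by rw [← mul_pow]; norm_num]
      nlinarith [mul_le_mul_of_nonneg_left hj (show (0 : ℝ) ≤ 2 ^ j by positivity),
        show (0 : ℝ) ≤ 2 ^ j * 8 ^ j by positivity]
    rw [e1, e2]
    calc _ ≤ j.factorial * D ^ (j + 1) * (1 / 4 * (16 ^ (j + 1) / q)) := by gcongr
      _ = _ := by ring
  linarith

end ArithmeticFunction.vonMangoldt

lemma Real.log_pow_le_factorial_mul_rpow {x θ : ℝ} (hx : 1 ≤ x) (hθ : 0 < θ) (j : ℕ) :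
    Real.log x ^ j ≤ j.factorial * (1 / θ) ^ j * x ^ θ := by
  have hlog := Real.log_nonneg hx
  have h := Real.pow_div_factorial_le_exp (θ * Real.log x) (by positivity) j
  have hpos : 0 < (j.factorial : ℝ) := by exact_mod_cast j.factorial_pos
  rw [div_le_iff₀ hpos, mul_pow] at h
  rw [Real.rpow_def_of_pos (by linarith), mul_comm (Real.log x) θ, one_div, inv_pow]
  calc Real.log x ^ j = (θ ^ j)⁻¹ * (θ ^ j * Real.log x ^ j) := by field_simp
    _ ≤ (θ ^ j)⁻¹ * (Real.exp (θ * Real.log x) * j.factorial) := by gcongr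
    _ = _ := by ring

lemma IsPrimePow.exists_sq_mul_cube {n : ℕ} (hn : IsPrimePow n) (hp : ¬ n.Prime) :
    ∃ x y : ℕ, n = x ^ 2 * y ^ 3 := by
  obtain ⟨p, i, hpp, hi, rfl⟩ := (isPrimePow_nat_iff n).mp hn
  have hi1 : i ≠ 1 := by rintro rfl; exact hp (by simpa using hpp)
  rcases Nat.even_or_odd' i with ⟨t, rfl | rfl⟩
  · exact ⟨p ^ t, 1, by ring⟩
  · obtain ⟨u, rfl⟩ : ∃ u, t = u + 1 := ⟨t - 1, by omega⟩
    exact ⟨p ^ u, p, by ring⟩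

lemma summable_indicator_isPrimePow_not_prime :
    Summable ({n : ℕ | IsPrimePow n ∧ ¬ n.Prime}.indicator fun n ↦ 1 / (n : ℝ) ^ (7 / 10 : ℝ)) := by
  rw [← summable_subtype_iff_indicator]
  choose f g hfg using fun n : {n : ℕ | IsPrimePow n ∧ ¬ n.Prime} ↦
    n.2.1.exists_sq_mul_cube n.2.2
  have h₁ : Summable fun x : ℕ ↦ 1 / (x : ℝ) ^ (7 / 5 : ℝ) :=
    Real.summable_one_div_nat_rpow.mpr (by norm_num)
  have h₂ : Summable fun x : ℕ ↦ 1 / (x : ℝ) ^ (21 / 10 : ℝ) :=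
    Real.summable_one_div_nat_rpow.mpr (by norm_num)
  have hsum := h₁.mul_of_nonneg h₂ (fun _ ↦ by positivity) (fun _ ↦ by positivity)
  have hinj : Function.Injective fun n ↦ (f n, g n) := by
    intro n m h
    rw [Prod.mk.injEq] at h
    exact Subtype.ext (by rw [hfg n, hfg m, h.1, h.2])
  refine (hsum.comp_injective hinj).congr fun n ↦ ?_
  have h : (n : ℝ) = (f n : ℝ) ^ (2 : ℝ) * (g n : ℝ) ^ (3 : ℝ) := by
    rw [Real.rpow_ofNat, Real.rpow_ofNat]
    exact_mod_cast hfg n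
  simp only [Function.comp_apply]
  rw [h, Real.mul_rpow (by positivity) (by positivity), ← Real.rpow_mul (by positivity),
    ← Real.rpow_mul (by positivity), ← one_div_mul_one_div]
  norm_num

namespace ArithmeticFunction.vonMangoldt

lemma nonprime_term_le {q : ℕ} (a : ZMod q) (j : ℕ) {η : ℝ} (hη : 0 < η) (n : ℕ) :
    (if n.Prime then 0 else residueClass a n * Real.log n ^ j / (n : ℝ) ^ (1 + η)) ≤
      j.factorial * 4 ^ j * 20 * {n : ℕ | IsPrimePow n ∧ ¬ n.Prime}.indicator
        (fun n ↦ 1 / (n : ℝ) ^ (7 / 10 : ℝ)) n := by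
  by_cases hn : IsPrimePow n ∧ ¬ n.Prime
  · rw [Set.indicator_of_mem (by exact hn), if_neg hn.2]
    have hn1 : (1 : ℝ) ≤ n := by exact_mod_cast hn.1.one_lt.le
    have hn0 : (0 : ℝ) < n := by linarith
    have h₁ : residueClass a n ≤ 20 * (n : ℝ) ^ (1 / 20 : ℝ) := by
      have := Real.log_le_rpow_div hn0.le (show (0 : ℝ) < 1 / 20 by norm_num)
      have := ((residueClass_le a n).trans vonMangoldt_le_log).trans this
      linarith
    have h₂ := Real.log_pow_le_factorial_mul_rpow hn1 (show (0 : ℝ) < 1 / 4 by norm_num) j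
    rw [one_div_one_div] at h₂
    have h₃ : (n : ℝ) ^ (1 / 20 : ℝ) * (n : ℝ) ^ (1 / 4 : ℝ) / (n : ℝ) ^ (1 + η) ≤
        1 / (n : ℝ) ^ (7 / 10 : ℝ) := by
      rw [← Real.rpow_add hn0, ← Real.rpow_sub hn0, one_div (_ ^ _), ← Real.rpow_neg hn0.le]
      exact Real.rpow_le_rpow_of_exponent_le hn1 (by linarith)
    have hlog := Real.log_nonneg hn1
    calc residueClass a n * Real.log n ^ j / (n : ℝ) ^ (1 + η)
        ≤ 20 * (n : ℝ) ^ (1 / 20 : ℝ) * (j.factorial * 4 ^ j * (n : ℝ) ^ (1 / 4 : ℝ)) /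
          (n : ℝ) ^ (1 + η) := by gcongr
      _ = j.factorial * 4 ^ j * 20 *
          ((n : ℝ) ^ (1 / 20 : ℝ) * (n : ℝ) ^ (1 / 4 : ℝ) / (n : ℝ) ^ (1 + η)) := by ring
      _ ≤ _ := by gcongr
  · rw [Set.indicator_of_notMem (by exact hn), mul_zero]
    split_ifs with hp
    · exact le_rfl
    · have h0 : residueClass a n ≤ 0 := by
        refine (residueClass_le a n).trans_eq (vonMangoldt_eq_zero_iff.mpr fun h ↦ hn ⟨h, hp⟩)
      rw [le_antisymm h0 (residueClass_nonneg a n), zero_mul, zero_div]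

/-- Proper prime powers contribute little to sums of `Λ(n) (log n) ^ j n ^ (-1 - η)`. -/
lemma exists_le_tsum_prime : ∃ C : ℝ, ∀ {q : ℕ} [NeZero q] (a : ZMod q) {j : ℕ} {η : ℝ}
    (_ : 0 < η) (_ : C * η * (q * (4 * η) ^ j) ≤ 1)
    (_ : 3 / 4 * (j.factorial / (q * η ^ (j + 1))) ≤
      ∑' n : ℕ, residueClass a n * Real.log n ^ j / (n : ℝ) ^ (1 + η)),
    1 / 2 * (j.factorial / (q * η ^ (j + 1))) ≤
      ∑' n : ℕ, if n.Prime then residueClass a n * Real.log n ^ j / (n : ℝ) ^ (1 + η) else 0 := by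
  set c := ∑' n, {n : ℕ | IsPrimePow n ∧ ¬ n.Prime}.indicator
    (fun n ↦ 1 / (n : ℝ) ^ (7 / 10 : ℝ)) n with hc
  refine ⟨80 * c, fun {q} _ a {j} {η} hη hC h ↦ ?_⟩
  have hq0 : 0 < (q : ℝ) := by exact_mod_cast NeZero.pos q
  have hpos : 0 < (j.factorial : ℝ) := by exact_mod_cast j.factorial_pos
  set F := fun n : ℕ ↦ residueClass a n * Real.log n ^ j / (n : ℝ) ^ (1 + η) with hF
  have hFs : Summable F := summable_residueClass_mul_log_pow a j (by linarith)
  have hF0 (n : ℕ) : 0 ≤ F n := by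
    have := residueClass_nonneg a n
    have := Real.log_natCast_nonneg n
    simp only [hF]
    positivity
  have hs₁ : Summable fun n : ℕ ↦ if n.Prime then F n else 0 :=
    hFs.of_nonneg_of_le (fun n ↦ by split_ifs <;> simp [hF0]) fun n ↦ by split_ifs <;> simp [hF0]
  have hs₂ : Summable fun n : ℕ ↦ if n.Prime then 0 else F n :=
    hFs.of_nonneg_of_le (fun n ↦ by split_ifs <;> simp [hF0]) fun n ↦ by split_ifs <;> simp [hF0]
  have hsplit : ∑' n, F n =
      (∑' n : ℕ, if n.Prime then F n else 0) + ∑' n : ℕ, if n.Prime then 0 else F n := by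
    rw [← hs₁.tsum_add hs₂]
    exact tsum_congr fun n ↦ by split_ifs <;> simp
  have hle : (∑' n : ℕ, if n.Prime then 0 else F n) ≤ j.factorial * 4 ^ j * 20 * c := by
    rw [hc, ← tsum_mul_left]
    exact hs₂.tsum_le_tsum (nonprime_term_le a j hη)
      (summable_indicator_isPrimePow_not_prime.mul_left _)
  have hle' : (j.factorial * 4 ^ j * 20 * c : ℝ) ≤ 1 / 4 * (j.factorial / (q * η ^ (j + 1))) := by
    rw [← mul_div_assoc, le_div_iff₀ (by positivity)]
    calc (j.factorial * 4 ^ j * 20 * c * (q * η ^ (j + 1)) : ℝ)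
        = j.factorial * (80 * c * η * (q * (4 * η) ^ j)) / 4 := by rw [mul_pow]; ring
      _ ≤ j.factorial * 1 / 4 := by gcongr
      _ = _ := by ring
  linarith

end ArithmeticFunction.vonMangoldt

namespace ArithmeticFunction.vonMangoldt

lemma rpow_neg_mul_log_pow_le {q m j : ℕ} (hq : 0 < q) (hm : 0 < m) {η : ℝ} (hη : 0 < η) :
    Real.log (q * m + 1 : ℕ) ^ (j + 1) / ((q * m + 1 : ℕ) : ℝ) ^ (1 + η) ≤
      3 * (j + 1).factorial / (q * η ^ (j + 1)) * (1 / (m : ℝ) ^ (1 + η / (j + 2))) := by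
  set x : ℝ := ((q * m + 1 : ℕ) : ℝ) with hx
  have hq1 : (1 : ℝ) ≤ q := by exact_mod_cast hq
  have hm1 : (1 : ℝ) ≤ m := by exact_mod_cast hm
  have hqmx : (q * m : ℝ) ≤ x := by rw [hx]; push_cast; linarith
  have hx1 : 1 ≤ x := by rw [hx]; push_cast; nlinarith
  have hx0 : 0 < x := by linarith
  set θ : ℝ := η * (j + 1) / (j + 2) with hθ
  set ε : ℝ := η / (j + 2) with hε
  have hθ0 : 0 < θ := by positivity
  have hε0 : 0 < ε := by positivity
  have hθε : θ + ε = η := by rw [hθ, hε]; field_simp; ring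
  have h₁ := Real.log_pow_le_factorial_mul_rpow hx1 hθ0 (j + 1)
  have h₂ : (1 / θ) ^ (j + 1) ≤ 3 / η ^ (j + 1) := by
    have h : 1 / θ = (1 + 1 / (j + 1 : ℝ)) * (1 / η) := by rw [hθ]; field_simp; ring
    have h' : (1 + 1 / (j + 1 : ℝ)) ^ (j + 1) ≤ 3 := by
      calc (1 + 1 / (j + 1 : ℝ)) ^ (j + 1) ≤ Real.exp (1 / (j + 1 : ℝ)) ^ (j + 1) := by
            gcongr
            rw [add_comm]
            exact Real.add_one_le_exp _
        _ = Real.exp 1 := by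
            rw [← Real.exp_nat_mul]
            congr 1
            push_cast
            field_simp
        _ ≤ 3 := by linarith [Real.exp_one_lt_d9]
    rw [h, mul_pow, one_div_pow η, mul_one_div]
    gcongr
  have h₃ : x ^ θ / x ^ (1 + η) = 1 / x ^ (1 + ε) := by
    rw [← Real.rpow_sub hx0, one_div, ← Real.rpow_neg hx0.le]
    congr 1
    linarith
  have h₄ : q * (m : ℝ) ^ (1 + ε) ≤ x ^ (1 + ε) := by
    calc q * (m : ℝ) ^ (1 + ε) ≤ (q : ℝ) ^ (1 + ε) * (m : ℝ) ^ (1 + ε) := by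
          gcongr
          exact Real.self_le_rpow_of_one_le hq1 (by linarith)
      _ = (q * m : ℝ) ^ (1 + ε) := by rw [Real.mul_rpow (by positivity) (by positivity)]
      _ ≤ x ^ (1 + ε) := by gcongr
  calc Real.log x ^ (j + 1) / x ^ (1 + η)
      ≤ ((j + 1).factorial * (3 / η ^ (j + 1)) * x ^ θ) / x ^ (1 + η) := by
        gcongr
        exact h₁.trans (by gcongr)
    _ = 3 * (j + 1).factorial / η ^ (j + 1) * (x ^ θ / x ^ (1 + η)) := by ring
    _ = 3 * (j + 1).factorial / η ^ (j + 1) * (1 / x ^ (1 + ε)) := by rw [h₃]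
    _ ≤ 3 * (j + 1).factorial / η ^ (j + 1) * (1 / (q * (m : ℝ) ^ (1 + ε))) := by gcongr
    _ = _ := by field_simp

lemma tsum_prime_residueClass_one_eq {q j : ℕ} (hq : 1 < q) {η : ℝ} :
    (∑' n : ℕ, if n.Prime then residueClass (1 : ZMod q) n * Real.log n ^ j / (n : ℝ) ^ (1 + η)
      else 0) =
    ∑' m : ℕ, if (q * (m + 1) + 1).Prime then
      Real.log (q * (m + 1) + 1 : ℕ) ^ (j + 1) / ((q * (m + 1) + 1 : ℕ) : ℝ) ^ (1 + η) else 0 := by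
  have hinj : Function.Injective fun m : ℕ ↦ q * (m + 1) + 1 := fun a b h ↦ by
    have := Nat.eq_of_mul_eq_mul_left (by omega) (Nat.add_right_cancel h)
    omega
  rw [← hinj.tsum_eq]
  · refine tsum_congr fun m ↦ ?_
    split_ifs with hp
    · rw [residueClass, Set.indicator_of_mem (by simp), vonMangoldt_apply_prime hp, pow_succ']
    · rfl
  · intro n hn
    rw [Function.mem_support, ne_eq, ite_eq_right_iff, not_forall] at hn
    obtain ⟨hp, hn⟩ := hn
    have hmem : (n : ZMod q) = 1 := by
      by_contra hne
      exact hn (by rw [residueClass, Set.indicator_of_notMem (by exact hne), zero_mul, zero_div])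
    have hdvd : q ∣ n - 1 := by
      rw [← Nat.modEq_iff_dvd' hp.one_lt.le, ← ZMod.natCast_eq_natCast_iff, hmem, Nat.cast_one]
    obtain ⟨t, ht⟩ := hdvd
    have := hp.one_lt
    rcases t with _ | t
    · omega
    · exact ⟨t, by dsimp only; omega⟩

end ArithmeticFunction.vonMangoldt

namespace ArithmeticFunction.vonMangoldt

open DirichletCharacter Metric Finset

lemma le_tsum_prime_weights {q j : ℕ} (hq : 1 < q) {η : ℝ} (hη : 0 < η)
    (h : 1 / 2 * (j.factorial / (q * η ^ (j + 1))) ≤ ∑' n : ℕ, if n.Prime then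
      residueClass (1 : ZMod q) n * Real.log n ^ j / (n : ℝ) ^ (1 + η) else 0) :
    (1 : ℝ) ≤ ∑' m : ℕ, if (q * (m + 1) + 1).Prime then
      6 * (j + 1) * (1 / ((m + 1 : ℕ) : ℝ) ^ (1 + η / (j + 2))) else 0 := by
  have hq0 : (0 : ℝ) < q := by exact_mod_cast (by omega : 0 < q)
  have hpos : 0 < (j.factorial : ℝ) := by exact_mod_cast j.factorial_pos
  rw [tsum_prime_residueClass_one_eq hq] at h
  have hw : Summable fun m : ℕ ↦ 1 / ((m + 1 : ℕ) : ℝ) ^ (1 + η / (j + 2)) :=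
    (summable_nat_add_iff (f := fun m : ℕ ↦ 1 / (m : ℝ) ^ (1 + η / (j + 2))) 1).mpr
      (Real.summable_one_div_nat_rpow.mpr (lt_add_of_pos_right _ (by positivity)))
  have hs : Summable fun m : ℕ ↦ if (q * (m + 1) + 1).Prime then
      6 * (j + 1) * (1 / ((m + 1 : ℕ) : ℝ) ^ (1 + η / (j + 2))) else 0 :=
    (hw.mul_left (6 * (j + 1 : ℝ))).of_nonneg_of_le (fun m ↦ by split_ifs <;> positivity)
      (fun m ↦ by split_ifs <;> first | exact le_rfl | positivity)
  set c : ℝ := 1 / 2 * (j.factorial / (q * η ^ (j + 1))) with hc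
  have hc0 : 0 < c := by positivity
  have hle (m : ℕ) : (if (q * (m + 1) + 1).Prime then Real.log (q * (m + 1) + 1 : ℕ) ^ (j + 1) /
      ((q * (m + 1) + 1 : ℕ) : ℝ) ^ (1 + η) else 0) ≤ c * if (q * (m + 1) + 1).Prime then
      6 * (j + 1) * (1 / ((m + 1 : ℕ) : ℝ) ^ (1 + η / (j + 2))) else 0 := by
    split_ifs
    · refine (rpow_neg_mul_log_pow_le (by omega) m.succ_pos hη).trans_eq ?_
      rw [hc, Nat.factorial_succ]
      push_cast
      ring
    · rw [mul_zero]
  have h' := h.trans (((hs.mul_left c).of_nonneg_of_le (fun m ↦ by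
    split_ifs
    · have := Real.log_natCast_nonneg (q * (m + 1) + 1)
      positivity
    · exact le_rfl) hle).tsum_le_tsum hle (hs.mul_left c))
  rw [tsum_mul_left] at h'
  exact le_of_mul_le_mul_left (by rwa [mul_one]) hc0

/-- If `Q` is odd, `M = Q ^ (k * N)`, and `a` is a finite family of divisors of `Q ^ N`, then many
of the numbers `M * a i * m + 1` are prime for a suitable `m`. -/
lemma exists_card_le_of_card_prime_le {Q : ℕ} (hQ : Odd Q) (hQ1 : 1 < Q) {k : ℕ} (hk : 0 < k) :
    ∃ B : ℝ, ∃ N₀ : ℕ, ∀ N ≥ N₀, ∀ {ι : Type} [Fintype ι] (a : ι → ℕ) (_ : ∀ i, a i ∣ Q ^ N) (T : ℕ)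
      (_ : ∀ m, 0 < m → #{i | (Q ^ (k * N) * a i * m + 1).Prime} ≤ T),
      (Fintype.card ι : ℝ) ≤ B * T * N ^ 11 := by
  obtain ⟨C, hC1, L₀, hC⟩ := exists_zeroFree_of_dvd_pow hQ hQ1
  obtain ⟨C', hC'⟩ := exists_le_tsum_prime
  refine ⟨588 * C * ((k + 1) * Q) ^ 11, max 1 ⌈max L₀ C'⌉₊, fun N hN ι _ a ha T hT ↦ ?_⟩
  simp only [ge_iff_le, sup_le_iff] at hN
  obtain ⟨hN1, hN⟩ := hN
  have hN' := max_le_iff.mp (Nat.ceil_le.mp hN)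
  set L : ℕ := (k + 1) * Q * N with hL
  have hNL : N ≤ L := Nat.le_mul_of_pos_left _ (by positivity)
  have hNL' : (N : ℝ) ≤ L := by exact_mod_cast hNL
  have hL1 : (1 : ℝ) ≤ L := by exact_mod_cast hN1.trans hNL
  have hL9 : (L : ℝ) ≤ L ^ 9 := le_self_pow₀ hL1 (by norm_num)
  set D : ℝ := C * L ^ 9 with hD
  have hLD : (L : ℝ) ≤ D := hL9.trans (le_mul_of_one_le_left (by positivity) hC1)
  have hD1 : 1 ≤ D := hL1.trans hLD
  set η : ℝ := 1 / (16 * D) with hη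
  have hη0 : 0 < η := by positivity
  have hη1 : 12 * η ≤ 1 := by
    rw [hη, mul_one_div, div_le_one (by positivity)]
    linarith
  have hηL : L * η ≤ 1 := by
    rw [hη, mul_one_div, div_le_one (by positivity)]
    linarith
  have hkey (i : ι) : (1 : ℝ) ≤ ∑' m : ℕ, if (Q ^ (k * N) * a i * (m + 1) + 1).Prime then
      6 * (L + 1) * (1 / ((m + 1 : ℕ) : ℝ) ^ (1 + η / (L + 2))) else 0 := by
    set q := Q ^ (k * N) * a i with hq
    have hqQ : q ∣ Q ^ ((k + 1) * N) := by
      rw [hq, add_mul, one_mul, pow_add]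
      exact mul_dvd_mul_left _ (ha i)
    have hQq : Q ∣ q := (dvd_pow_self Q (by positivity)).mul_right _
    have hq0 : q ≠ 0 := fun h ↦ by
      rw [h, zero_dvd_iff] at hqQ
      exact pow_ne_zero _ (by omega) hqQ
    have : NeZero q := ⟨hq0⟩
    have hq1 : 1 < q := hQ1.trans_le (Nat.le_of_dvd (Nat.pos_of_ne_zero hq0) hQq)
    have hqpos : (0 : ℝ) < q := by exact_mod_cast (by omega : 0 < q)
    have hlog : Real.log q ≤ L := by
      calc Real.log q ≤ Real.log ((Q : ℝ) ^ ((k + 1) * N)) := by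
            refine Real.log_le_log hqpos ?_
            exact_mod_cast Nat.le_of_dvd (by positivity) hqQ
        _ = ((k + 1) * N : ℕ) * Real.log Q := Real.log_pow _ _
        _ ≤ ((k + 1) * N : ℕ) * Q := by
            gcongr
            exact Real.log_le_self (by positivity)
        _ = L := by rw [hL]; push_cast; ring
    have hq3 : (q : ℝ) ≤ 3 ^ L := by
      calc (q : ℝ) = Real.exp (Real.log q) := (Real.exp_log hqpos).symm
        _ ≤ Real.exp L := Real.exp_le_exp.mpr hlog
        _ = Real.exp 1 ^ L := by rw [← Real.exp_nat_mul, mul_one]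
        _ ≤ 3 ^ L := by
            gcongr
            linarith [Real.exp_one_lt_d9]
    have hball {s : ℂ} (hs : s ∈ ball (1 : ℂ) (1 / D)) := hC hQq hqQ (hN'.1.trans hNL') hlog hs
    refine le_tsum_prime_weights hq1 hη0 (hC' (1 : ZMod q) hη0 ?_
      (le_tsum_residueClass_mul_log_pow hD1 (fun s hs ↦ (hball hs).1) (fun s hs ↦ (hball hs).2) hη
        (hq3.trans (by gcongr; norm_num))))
    have hX : q * (4 * η) ^ L ≤ 1 := by
      calc q * (4 * η) ^ L ≤ 3 ^ L * (4 * η) ^ L := by gcongr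
        _ = (12 * η) ^ L := by rw [← mul_pow]; ring
        _ ≤ 1 := pow_le_one₀ (by positivity) hη1
    calc C' * η * (q * (4 * η) ^ L) ≤ L * η * (q * (4 * η) ^ L) := by
          gcongr
          exact hN'.2.trans hNL'
      _ ≤ 1 * 1 := by gcongr
      _ = 1 := one_mul 1
  set w : ℕ → ℝ := fun m ↦ 6 * (L + 1) * (1 / ((m + 1 : ℕ) : ℝ) ^ (1 + η / (L + 2))) with hw
  have hw0 (m : ℕ) : 0 ≤ w m := by positivity
  have hε : 0 < η / (L + 2) := by positivity
  have hws : Summable w := ((summable_nat_add_iff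
    (f := fun m : ℕ ↦ 1 / (m : ℝ) ^ (1 + η / (L + 2))) 1).mpr
      (Real.summable_one_div_nat_rpow.mpr (lt_add_of_pos_right _ hε))).mul_left _
  have hwi (i : ι) : Summable fun m : ℕ ↦
      if (Q ^ (k * N) * a i * (m + 1) + 1).Prime then w m else 0 :=
    hws.of_nonneg_of_le (fun m ↦ by split_ifs <;> simp [hw0])
      (fun m ↦ by split_ifs <;> simp [hw0])
  calc (Fintype.card ι : ℝ) = ∑ i : ι, (1 : ℝ) := by simp
    _ ≤ ∑ i : ι, ∑' m : ℕ, if (Q ^ (k * N) * a i * (m + 1) + 1).Prime then w m else 0 :=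
        sum_le_sum fun i _ ↦ hkey i
    _ = ∑' m : ℕ, ∑ i : ι, if (Q ^ (k * N) * a i * (m + 1) + 1).Prime then w m else 0 :=
        (Summable.tsum_finsetSum fun i _ ↦ hwi i).symm
    _ ≤ ∑' m : ℕ, T * w m := by
        refine (summable_sum fun i _ ↦ hwi i).tsum_le_tsum (fun m ↦ ?_) (hws.mul_left _)
        rw [← sum_filter, sum_const, nsmul_eq_mul]
        have := hw0 m
        gcongr
        exact hT (m + 1) m.succ_pos
    _ = T * (6 * (L + 1) * ∑' m : ℕ, 1 / ((m + 1 : ℕ) : ℝ) ^ (1 + η / (L + 2))) := by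
        rw [tsum_mul_left, hw, tsum_mul_left]
    _ ≤ T * (6 * (2 * L) * (1 + 1 / (η / (L + 2)))) := by
        gcongr
        · linarith
        · exact tsum_inv_succ_rpow_le hε
    _ ≤ T * (6 * (2 * L) * (49 * (C * L ^ 10))) := by
        gcongr
        have h₁ : 1 / (η / (L + 2)) = 16 * (C * L ^ 9) * (L + 2) := by
          rw [hη, hD]
          field_simp
        have h₂ : 1 ≤ C * L ^ 9 := hD1
        have h₃ : C * (L : ℝ) ^ 10 = C * L ^ 9 * L := by ring
        rw [h₁, h₃]
        nlinarith
    _ = 588 * C * ((k + 1) * Q) ^ 11 * T * N ^ 11 := by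
        rw [hL]
        push_cast
        ring

end ArithmeticFunction.vonMangoldt

lemma Nat.totient_prod_of_prime {κ : Type*} [DecidableEq κ] {S : Finset κ} {f : κ → ℕ}
    (hf : ∀ v ∈ S, (f v).Prime) (hinj : Set.InjOn f S) :
    Nat.totient (∏ v ∈ S, f v) = ∏ v ∈ S, (f v - 1) := by
  induction S using Finset.induction_on with
  | empty => simp
  | insert a S ha ih =>
    rw [Finset.prod_insert ha, Finset.prod_insert ha, Nat.totient_mul,
      Nat.totient_prime (hf a (Finset.mem_insert_self a S)),
      ih (fun v hv ↦ hf v (Finset.mem_insert_of_mem hv))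
        (hinj.mono (by simp))]
    refine Nat.Coprime.prod_right fun v hv ↦ ?_
    rw [Nat.coprime_primes (hf a (Finset.mem_insert_self a S))
      (hf v (Finset.mem_insert_of_mem hv))]
    intro h
    have := hinj (by simp) (by simp [hv]) h
    exact ha (this ▸ hv)

lemma IsCarmichael.sub_one_dvd_sub_one {n p : ℕ} (hn : IsCarmichael n) (hp : p.Prime)
    (hpn : p ∣ n) : p - 1 ∣ n - 1 := by
  have : Fact p.Prime := ⟨hp⟩
  obtain ⟨g, hg⟩ := IsCyclic.exists_generator (α := (ZMod p)ˣ)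
  have hord : orderOf g = p - 1 := by
    rw [orderOf_eq_card_of_forall_mem_zpowers hg, Nat.card_eq_fintype_card, ZMod.card_units]
  rw [← hord]
  refine orderOf_dvd_of_pow_eq_one ?_
  have h := (hn.2.2 ((g : ZMod p).val : ℤ)).of_dvd (Int.natCast_dvd_natCast.mpr hpn)
  rw [← ZMod.intCast_eq_intCast_iff] at h
  push_cast at h
  rw [ZMod.natCast_zmod_val] at h
  have hpow : g ^ n = g := Units.ext (by simpa using h)
  obtain ⟨t, rfl⟩ : ∃ t, n = t + 1 := ⟨n - 1, by have := hn.1; omega⟩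
  rw [pow_succ] at hpow
  simpa using hpow

/-- A criterion for a product of primes `c * x v + 1` to be a `k`-Lehmer number that is neither a
`(k - 1)`-Lehmer number nor a Carmichael number. -/
lemma kLehmer_not_carmichael_prod {κ : Type*} [DecidableEq κ] {k : ℕ} (hk : 3 ≤ k) {v₀ : κ}
    {W : Finset κ} (hv₀ : v₀ ∉ W) (hW : W.card = k - 2) {c : ℕ} (hc : 0 < c) {x : κ → ℕ}
    (hx : ∀ v ∈ insert v₀ W, 0 < x v)
    (hprime : ∀ v ∈ insert v₀ W, (c * x v + 1).Prime)
    (hinj : Set.InjOn x (insert v₀ W : Finset κ)) (hdvd : ∏ v ∈ insert v₀ W, x v ∣ c)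
    {l : ℕ} (hl : l.Prime)
    (hlt : ∀ w ∈ W, (x v₀).factorization l < (x w).factorization l) :
    c < ∏ v ∈ insert v₀ W, (c * x v + 1) ∧
    ¬ (∏ v ∈ insert v₀ W, (c * x v + 1)).Prime ∧
    Nat.totient (∏ v ∈ insert v₀ W, (c * x v + 1)) ∣
      (∏ v ∈ insert v₀ W, (c * x v + 1) - 1) ^ k ∧
    ¬ Nat.totient (∏ v ∈ insert v₀ W, (c * x v + 1)) ∣
      (∏ v ∈ insert v₀ W, (c * x v + 1) - 1) ^ (k - 1) ∧
    ¬ IsCarmichael (∏ v ∈ insert v₀ W, (c * x v + 1)) := by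
  have hfinj : Set.InjOn (fun v ↦ c * x v + 1) (insert v₀ W : Finset κ) := fun a ha b hb h ↦
    hinj ha hb (Nat.eq_of_mul_eq_mul_left hc (Nat.add_right_cancel h))
  set n := ∏ v ∈ insert v₀ W, (c * x v + 1) with hn
  have hφ : n.totient = ∏ v ∈ insert v₀ W, (c * x v) := Nat.totient_prod_of_prime hprime hfinj
  have hmem₀ : v₀ ∈ insert v₀ W := Finset.mem_insert_self _ _
  have hsplit : n = (c * x v₀ + 1) * ∏ v ∈ W, (c * x v + 1) := Finset.prod_insert hv₀
  have hn0 : 0 < n := Finset.prod_pos fun v _ ↦ Nat.succ_pos _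
  have hcn : c < n := by
    have h₁ : c * x v₀ + 1 ≤ n := Nat.le_of_dvd hn0 (Finset.dvd_prod_of_mem _ hmem₀)
    have h₂ : c ≤ c * x v₀ := Nat.le_mul_of_pos_right _ (hx v₀ hmem₀)
    omega
  obtain ⟨b, hb⟩ : W.Nonempty := Finset.card_pos.mp (by omega)
  have hmemb : b ∈ insert v₀ W := Finset.mem_insert_of_mem hb
  set e := (c * x v₀).factorization l with he
  have hcx₀ : c * x v₀ ≠ 0 := (Nat.mul_pos hc (hx v₀ hmem₀)).ne'
  have hpow (w : κ) (hw : w ∈ W) : l ^ (e + 1) ∣ c * x w := by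
    have hxw := (hx w (Finset.mem_insert_of_mem hw)).ne'
    rw [hl.pow_dvd_iff_le_factorization (Nat.mul_ne_zero hc.ne' hxw), he,
      Nat.factorization_mul hc.ne' (hx v₀ hmem₀).ne', Nat.factorization_mul hc.ne' hxw]
    simp only [Finsupp.coe_add, Pi.add_apply]
    have := hlt w hw
    omega
  have hmod : n ≡ c * x v₀ + 1 [MOD l ^ (e + 1)] := by
    rw [hsplit]
    refine (Nat.ModEq.mul_left _ (Nat.ModEq.prod_one fun w hw ↦ ?_)).trans (by rw [mul_one])
    exact ((Nat.modEq_zero_iff_dvd.mpr (hpow w hw)).add_right 1)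
  have hnot : ¬ l ^ (e + 1) ∣ n - 1 := by
    intro h
    have h₁ : 1 ≡ n [MOD l ^ (e + 1)] := (Nat.modEq_iff_dvd' hn0).mpr h
    have h₂ := (Nat.modEq_iff_dvd' (by omega)).mp (h₁.trans hmod)
    rw [Nat.add_sub_cancel, hl.pow_dvd_iff_le_factorization hcx₀] at h₂
    omega
  refine ⟨hcn, fun hp ↦ ?_, ?_, fun h ↦ ?_, fun h ↦ ?_⟩
  · have h₁ := (Nat.prime_dvd_prime_iff_eq (hprime v₀ hmem₀) hp).mp
      (Finset.dvd_prod_of_mem _ hmem₀)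
    have h₂ := (Nat.prime_dvd_prime_iff_eq (hprime b hmemb) hp).mp
      (Finset.dvd_prod_of_mem _ hmemb)
    exact hv₀ (hfinj hmemb hmem₀ (h₂.trans h₁.symm) ▸ hb)
  · have hcdvd : c ∣ n - 1 := by
      refine (Nat.modEq_iff_dvd' hn0).mp (Nat.ModEq.prod_one fun v _ ↦ ?_).symm
      exact (Nat.modEq_zero_iff_dvd.mpr (dvd_mul_right c (x v))).add_right 1
    rw [hφ, Finset.prod_mul_distrib, Finset.prod_const, Finset.card_insert_of_notMem hv₀, hW]
    refine (mul_dvd_mul_left _ hdvd).trans ?_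
    rw [← pow_succ, show k - 2 + 1 + 1 = k by omega]
    exact pow_dvd_pow_of_dvd hcdvd k
  · have h₁ : l ^ (e + (e + 1) * (k - 2)) ∣ (n - 1) ^ (k - 1) := by
      refine dvd_trans ?_ h
      rw [hφ, Finset.prod_insert hv₀, pow_add, pow_mul]
      refine mul_dvd_mul (Nat.ordProj_dvd _ _) ?_
      rw [← hW, ← Finset.prod_const]
      exact Finset.prod_dvd_prod_of_dvd _ _ hpow
    have hn1 : n - 1 ≠ 0 := by omega
    rw [hl.pow_dvd_iff_le_factorization (pow_ne_zero _ hn1), Nat.factorization_pow] at h₁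
    rw [hl.pow_dvd_iff_le_factorization hn1, not_le] at hnot
    simp only [Finsupp.coe_smul, Pi.smul_apply, smul_eq_mul] at h₁
    have h₂ : (k - 1) * (n - 1).factorization l ≤ (k - 1) * e := Nat.mul_le_mul_left _ (by omega)
    obtain ⟨t, rfl⟩ : ∃ t, k = t + 3 := ⟨k - 3, by omega⟩
    simp only [show t + 3 - 2 = t + 1 by omega, show t + 3 - 1 = t + 2 by omega] at h₁ h₂
    nlinarith
  · have := h.sub_one_dvd_sub_one (hprime b hmemb) (Finset.dvd_prod_of_mem _ hmemb)
    rw [Nat.add_sub_cancel] at this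
    exact hnot ((hpow b hb).trans this)

lemma exists_lt_card_image_apply {ι α : Type*} [Fintype ι] [DecidableEq ι] [DecidableEq α]
    {B : Finset (ι → α)} {T : ℕ} (hB : T ^ Fintype.card ι < B.card) :
    ∃ i, T < (B.image fun e ↦ e i).card := by
  by_contra! h
  have hsub : B ⊆ Fintype.piFinset fun i ↦ B.image fun e ↦ e i := fun e he ↦
    Fintype.mem_piFinset.mpr fun i ↦ Finset.mem_image_of_mem _ he
  have := Finset.card_le_card hsub
  rw [Fintype.card_piFinset] at this
  have h' := Finset.prod_le_pow_card Finset.univ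
    (fun i ↦ (B.image fun e : ι → α ↦ e i).card) T fun i _ ↦ h i
  rw [Finset.card_univ] at h'
  omega

lemma factorization_prod_pow_of_injective {ι : Type*} [Fintype ι] {l : ι → ℕ}
    (hl : ∀ i, (l i).Prime) (hinj : Function.Injective l) (e : ι → ℕ) (i : ι) :
    (∏ j, l j ^ e j).factorization (l i) = e i := by
  classical
  rw [Nat.factorization_prod fun j _ ↦ pow_ne_zero _ (hl j).ne_zero, Finset.sum_apply',
    Finset.sum_eq_single i]
  · rw [(hl i).factorization_pow, Finsupp.single_eq_same]
  · intro j _ hj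
    rw [(hl j).factorization_pow, Finsupp.single_eq_of_ne]
    exact fun h ↦ hj (hinj h.symm)
  · simp

/-- For every `k ≥ 3` there are infinitely many composite `n` such that
`φ n ∣ (n - 1) ^ k`, `φ n ∤ (n - 1) ^ (k - 1)`, and `n` is not Carmichael. -/
theorem infinitely_many_kLehmer_not_carmichael (k : ℕ) (hk : 3 ≤ k) :
    {n : ℕ | 1 < n ∧ ¬ n.Prime ∧
      Nat.totient n ∣ (n - 1) ^ k ∧ ¬ Nat.totient n ∣ (n - 1) ^ (k - 1) ∧
      ¬ IsCarmichael n}.Infinite := by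
  let l : Fin 12 → ℕ := fun i ↦ Nat.nth Nat.Prime (i + 1)
  have hl (i : Fin 12) : (l i).Prime := Nat.prime_nth_prime _
  have hinj : Function.Injective l := fun i j h ↦ by
    have := Nat.nth_injective Nat.infinite_setOfPred_prime h
    exact Fin.ext (by omega)
  have hodd (i : Fin 12) : Odd (l i) := by
    refine (hl i).odd_of_ne_two fun h ↦ ?_
    have h₀ : Nat.nth Nat.Prime 0 < l i :=
      (Nat.nth_lt_nth Nat.infinite_setOfPred_prime).mpr (Nat.succ_pos _)
    have := (Nat.prime_nth_prime 0).two_le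
    omega
  set Q := ∏ i, l i with hQ
  have hQodd : Odd Q := Finset.prod_induction l Odd (fun _ _ ↦ Odd.mul) odd_one fun i _ ↦ hodd i
  have hQ1 : 1 < Q := (hl 0).one_lt.trans_le
    (Nat.le_of_dvd hQodd.pos (Finset.dvd_prod_of_mem l (Finset.mem_univ 0)))
  obtain ⟨B, N₀, hB⟩ :=
    ArithmeticFunction.vonMangoldt.exists_card_le_of_card_prime_le hQodd hQ1 (k := k) (by omega)
  refine Set.infinite_of_forall_exists_gt fun b ↦ ?_
  obtain ⟨N, hNN₀, hNB, hNb⟩ : ∃ N : ℕ, N₀ ≤ N ∧ B * ((k - 2) ^ 12 : ℕ) ≤ N ∧ b + 1 ≤ N :=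
    ⟨max (max N₀ ⌈B * ((k - 2) ^ 12 : ℕ)⌉₊) (b + 1), by simp,
      Nat.ceil_le.mp ((le_max_right _ _).trans (le_max_left _ _)), le_max_right _ _⟩
  let a : (Fin 12 → Fin (N + 1)) → ℕ := fun e ↦ ∏ i, l i ^ (e i : ℕ)
  have ha (e : Fin 12 → Fin (N + 1)) : a e ∣ Q ^ N := by
    rw [hQ, ← Finset.prod_pow]
    exact Finset.prod_dvd_prod_of_dvd _ _ fun i _ ↦ pow_dvd_pow _ (Fin.is_le _)
  have hapos (e : Fin 12 → Fin (N + 1)) : 0 < a e := Finset.prod_pos fun i _ ↦ pow_pos (hl i).pos _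
  have hafac (e : Fin 12 → Fin (N + 1)) (i : Fin 12) : (a e).factorization (l i) = e i :=
    factorization_prod_pow_of_injective hl hinj (fun j ↦ (e j : ℕ)) i
  obtain ⟨m, hm, hcard⟩ : ∃ m, 0 < m ∧
      (k - 2) ^ 12 < (Finset.univ.filter fun e ↦ (Q ^ (k * N) * a e * m + 1).Prime).card := by
    by_contra! h
    have := hB N hNN₀ a ha ((k - 2) ^ 12) h
    rw [Fintype.card_fun, Fintype.card_fin, Fintype.card_fin] at this
    have h₁ : B * ((k - 2) ^ 12 : ℕ) * (N : ℝ) ^ 11 ≤ N * (N : ℝ) ^ 11 := by gcongr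
    have h₂ : (N : ℝ) ^ 12 < (N + 1) ^ 12 :=
      pow_lt_pow_left₀ (lt_add_one _) (by positivity) (by norm_num)
    push_cast at this h₁
    nlinarith
  set S := Finset.univ.filter fun e ↦ (Q ^ (k * N) * a e * m + 1).Prime with hS
  obtain ⟨i, hi⟩ := exists_lt_card_image_apply (B := S) (T := k - 2) (by rwa [Fintype.card_fin])
  set V := S.image fun e ↦ e i with hV
  have hVne : V.Nonempty := Finset.card_pos.mp (by omega)
  obtain ⟨W, hWV, hW⟩ := Finset.exists_subset_card_eq
    (show k - 2 ≤ (V.erase (V.min' hVne)).card by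
      rw [Finset.card_erase_of_mem (V.min'_mem hVne)]; omega)
  have hfV (v : Fin (N + 1)) : ∃ e, v ∈ V → e ∈ S ∧ e i = v := by
    by_cases hv : v ∈ V
    · obtain ⟨e, he⟩ := Finset.mem_image.mp hv
      exact ⟨e, fun _ ↦ he⟩
    · exact ⟨fun _ ↦ v, fun h ↦ (hv h).elim⟩
  choose f hf using hfV
  set v₀ := V.min' hVne with hv₀
  have hsub : insert v₀ W ⊆ V :=
    Finset.insert_subset (V.min'_mem hVne) (hWV.trans (Finset.erase_subset _ _))
  have hv₀W : v₀ ∉ W := fun h ↦ Finset.notMem_erase _ _ (hWV h)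
  have hc : 0 < Q ^ (k * N) * m := by positivity
  obtain ⟨h₁, h₂, h₃, h₄, h₅⟩ := kLehmer_not_carmichael_prod (x := fun v ↦ a (f v)) hk hv₀W hW hc
    (fun v _ ↦ hapos _)
    (fun v hv ↦ by
      have := (Finset.mem_filter.mp (hf v (hsub hv)).1).2
      rwa [mul_right_comm] at this)
    (fun v hv w hw h ↦ by
      have h' := congrArg (fun y ↦ Nat.factorization y (l i)) h
      simp only [hafac] at h'
      rw [(hf v (hsub hv)).2, (hf w (hsub hw)).2] at h'
      exact Fin.ext h')
    (by
      refine (Finset.prod_dvd_prod_of_dvd _ (fun _ ↦ Q ^ N) fun v _ ↦ ha _).trans ?_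
      rw [Finset.prod_const, Finset.card_insert_of_notMem hv₀W, hW, ← pow_mul]
      refine (pow_dvd_pow Q ?_).mul_right m
      rw [mul_comm]
      exact Nat.mul_le_mul_right N (by omega))
    (hl i)
    (fun w hw ↦ by
      simp only [hafac]
      rw [(hf w (hsub (Finset.mem_insert_of_mem hw))).2, (hf v₀ (V.min'_mem hVne)).2]
      exact Fin.lt_def.mp (lt_of_le_of_ne (V.min'_le w (Finset.mem_of_mem_erase (hWV hw)))
        (fun h ↦ hv₀W (h ▸ hw))))
  have hNlt : N < Q ^ (k * N) * m := by
    calc N ≤ k * N := Nat.le_mul_of_pos_left _ (by omega)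
      _ < Q ^ (k * N) := Nat.lt_pow_self hQ1
      _ ≤ _ := Nat.le_mul_of_pos_right _ hm
  exact ⟨_, ⟨by omega, h₂, h₃, h₄, h₅⟩, by omega⟩
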